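/- Consider the binary-action doubling-trick algorithm: fix η ∈ (0,1), α = 1/(1+η), an integer τ₀ ≥ 2, and for an integer K ≥ 1 let M = τ₀(2^K − 1), with episodes 𝒥_k (k = 1,…,K) of lengths |𝒥_k| = τ₀2^{k−1}, each split into an exploration phase ℐ_k of length ⌈|𝒥_k|^α⌉ and an exploitation phase ℐ'_k. Let D_1 : Θ → [0,1] be the true distribution map, r_a : Θ → ℝ with |r_a(θ)| ≤ L for a ∈ {0,1}, PR(θ) = D_1(θ)r_1(θ) + (1 − D_1(θ))r_0(θ), and θ* a minimizer of PR over Θ. During ℐ_k the deployed models θ_m are arbitrary; during ℐ'_k the algorithm deploys θ̂^{(k)} ∈ argmin_θ P̂R^{(k)}(θ), where P̂R^{(k)}(θ) = D̂_1^{(k)}(θ)r_1(θ) + (1 − D̂_1^{(k)}(θ))r_0(θ) for random estimates D̂_1^{(k)} : Θ → [0,1]. Let E_k = sup_{θ∈Θ}|D̂_1^{(k)}(θ) − D_1(θ)| and r_k = (log|ℐ_k| / |ℐ_k|)^η. Assume: for every ε > 0 there exist c > 0 and an integer K₀ such that for all K, ℙ(∃ k with K₀ ≤ k ≤ K and E_k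 > c·r_k) ≤ ε. Then the total regret Reg(M) = Σ_{m=1}^M (PR(θ_m) − PR(θ*)) satisfies Reg(M) = O_P(M^{1/(1+η)} log^η M): for every ε > 0 there exists C > 0 such that lim sup_{K→∞} ℙ( Reg(M) > C · M^{1/(1+η)} (1 + log M)^η ) ≤ ε. -/

import Mathlib

open MeasureTheory Filter

/-- Length `|𝒥_k| = τ₀ 2^{k-1}` of episode `k` in the doubling-trick algorithm. -/
def episodeLen (τ₀ k : ℕ) : ℕ := τ₀ * 2 ^ (k - 1)

/-- Length `|ℐ_k| = ⌈|𝒥_k|^α⌉` of the exploration phase of episode `k`. -/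
noncomputable def exploreLen (τ₀ : ℕ) (α : ℝ) (k : ℕ) : ℕ :=
  ⌈(episodeLen τ₀ k : ℝ) ^ α⌉₊

/-- First deployment index of episode `k` (episodes are `1`-indexed):
episode `k` consists of indices `m` with `τ₀(2^{k-1}-1) + 1 ≤ m ≤ τ₀(2^k - 1)`. -/
def episodeStart (τ₀ k : ℕ) : ℕ := τ₀ * (2 ^ (k - 1) - 1) + 1

/-- Last deployment index of episode `k`; also, `episodeEnd τ₀ K = M = τ₀(2^K - 1)` is the
total number of deployments after `K` episodes. -/
def episodeEnd (τ₀ k : ℕ) : ℕ := τ₀ * (2 ^ k - 1)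

lemma episodeLen_succ (τ₀ k : ℕ) : episodeLen τ₀ (k + 1) = τ₀ * 2 ^ k := rfl

lemma episodeStart_succ (τ₀ k : ℕ) : episodeStart τ₀ (k + 1) = episodeEnd τ₀ k + 1 := rfl

lemma episodeEnd_succ (τ₀ k : ℕ) :
    episodeEnd τ₀ (k + 1) = episodeEnd τ₀ k + episodeLen τ₀ (k + 1) := by
  have h : 1 ≤ 2 ^ k := Nat.one_le_two_pow
  rw [episodeEnd, episodeEnd, episodeLen_succ, ← mul_add, pow_succ]
  congr 1
  omega

lemma episodeLen_le_episodeEnd (τ₀ : ℕ) {k K : ℕ} (h : k < K) :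
    episodeLen τ₀ (k + 1) ≤ episodeEnd τ₀ K := by
  have h₁ : 2 ^ (k + 1) ≤ 2 ^ K := Nat.pow_le_pow_right two_pos h
  have h₂ : 1 ≤ 2 ^ k := Nat.one_le_two_pow
  rw [episodeEnd, episodeLen_succ]
  rw [pow_succ] at h₁
  exact Nat.mul_le_mul_left _ (by omega)

lemma episodeLen_mono (τ₀ : ℕ) : Monotone (episodeLen τ₀) := fun _ _ h =>
  Nat.mul_le_mul_left _ (Nat.pow_le_pow_right two_pos (Nat.sub_le_sub_right h 1))

lemma le_episodeLen (τ₀ k : ℕ) : τ₀ ≤ episodeLen τ₀ k :=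
  Nat.le_mul_of_pos_right _ (by positivity)

/-- A sum over all deployments is bounded episode by episode. -/
lemma sum_Icc_episodeEnd_le (τ₀ K : ℕ) (f : ℕ → ℝ) (b : ℕ → ℝ)
    (h : ∀ k < K, ∑ m ∈ Finset.Ioc (episodeEnd τ₀ k)
      (episodeEnd τ₀ k + episodeLen τ₀ (k + 1)), f m ≤ b k) :
    ∑ m ∈ Finset.Icc 1 (episodeEnd τ₀ K), f m ≤ ∑ k ∈ Finset.range K, b k := by
  change ∑ m ∈ Finset.Ioc 0 (episodeEnd τ₀ K), f m ≤ _
  induction K with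
  | zero => simp [episodeEnd]
  | succ K ih =>
    rw [Finset.sum_range_succ, episodeEnd_succ,
      ← Finset.sum_Ioc_consecutive f (Nat.zero_le _) (Nat.le_add_right _ _)]
    exact add_le_add (ih fun k hk => h k (by omega)) (h K (by omega))

/-- If the summand is at most `B` throughout a block of length `T` and at most `g` after its
first `n` terms, then the sum is at most `n * B + T * g`. -/
lemma sum_Ioc_le_of_two_phases (f : ℕ → ℝ) (a T n : ℕ) (B g : ℝ) (hB : 0 ≤ B) (hg : 0 ≤ g)
    (hfB : ∀ m, f m ≤ B) (hfg : ∀ m, a + n < m → m ≤ a + T → f m ≤ g) :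
    ∑ m ∈ Finset.Ioc a (a + T), f m ≤ n * B + T * g := by
  calc ∑ m ∈ Finset.Ioc a (a + T), f m
      ≤ ∑ m ∈ Finset.Ioc a (a + T), ((if m ≤ a + n then B else 0) + g) := by
        refine Finset.sum_le_sum fun m hm => ?_
        rw [Finset.mem_Ioc] at hm
        split_ifs with h
        · linarith [hfB m]
        · linarith [hfg m (by omega) hm.2]
    _ = ((Finset.Ioc a (a + T)).filter (· ≤ a + n)).card * B + T * g := by
        rw [Finset.sum_add_distrib, ← Finset.sum_filter]
        simp
    _ ≤ n * B + T * g := by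
        have hsub : (Finset.Ioc a (a + T)).filter (· ≤ a + n) ⊆ Finset.Ioc a (a + n) := by
          intro m hm
          simp only [Finset.mem_filter, Finset.mem_Ioc] at hm ⊢
          omega
        have hcard := Finset.card_le_card hsub
        rw [Nat.card_Ioc, Nat.add_sub_cancel_left] at hcard
        gcongr

/-- The geometric sum of the powers `|𝒥_k|^α` is dominated by `M^α`. -/
lemma sum_episodeLen_rpow_le (τ₀ : ℕ) {α : ℝ} (hα : 0 < α) {K : ℕ} (hK : 1 ≤ K) :
    ∑ k ∈ Finset.range K, (episodeLen τ₀ (k + 1) : ℝ) ^ α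
      ≤ (2 : ℝ) ^ α / ((2 : ℝ) ^ α - 1) * (episodeEnd τ₀ K : ℝ) ^ α := by
  have hq : 1 < (2 : ℝ) ^ α := Real.one_lt_rpow one_lt_two hα
  have hterm : ∀ k : ℕ, (episodeLen τ₀ (k + 1) : ℝ) ^ α = (τ₀ : ℝ) ^ α * ((2 : ℝ) ^ α) ^ k := by
    intro k
    rw [episodeLen_succ]
    push_cast
    rw [Real.mul_rpow (by positivity) (by positivity), Real.rpow_pow_comm zero_le_two]
  obtain ⟨k, rfl⟩ : ∃ k, K = k + 1 := ⟨K - 1, by omega⟩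
  have hlast : (episodeLen τ₀ (k + 1) : ℝ) ^ α ≤ (episodeEnd τ₀ (k + 1) : ℝ) ^ α := by
    have := episodeLen_le_episodeEnd τ₀ (Nat.lt_add_one k)
    gcongr
  have hq' : 0 < (2 : ℝ) ^ α - 1 := by linarith
  calc ∑ j ∈ Finset.range (k + 1), (episodeLen τ₀ (j + 1) : ℝ) ^ α
      = (τ₀ : ℝ) ^ α * ((((2 : ℝ) ^ α) ^ (k + 1) - 1) / ((2 : ℝ) ^ α - 1)) := by
        rw [Finset.sum_congr rfl fun j _ => hterm j, ← Finset.mul_sum, geom_sum_eq hq.ne']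
    _ ≤ (τ₀ : ℝ) ^ α * (((2 : ℝ) ^ α) ^ (k + 1) / ((2 : ℝ) ^ α - 1)) := by
        gcongr
        linarith
    _ = (2 : ℝ) ^ α / ((2 : ℝ) ^ α - 1) * (episodeLen τ₀ (k + 1) : ℝ) ^ α := by
        rw [hterm, pow_succ]
        ring
    _ ≤ _ := by gcongr

/-- The risk difference under two mixing weights is controlled by the weight difference. -/
lemma abs_mixture_sub_le {d d' x y L : ℝ} (hx : |x| ≤ L) (hy : |y| ≤ L) :
    |(d * x + (1 - d) * y) - (d' * x + (1 - d') * y)| ≤ 2 * L * |d - d'| := by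
  have h : (d * x + (1 - d) * y) - (d' * x + (1 - d') * y) = (x - y) * (d - d') := by ring
  rw [h, abs_mul]
  gcongr
  linarith [abs_sub x y]

lemma abs_mixture_le {d x y L : ℝ} (hd : d ∈ Set.Icc (0 : ℝ) 1) (hx : |x| ≤ L) (hy : |y| ≤ L) :
    |d * x + (1 - d) * y| ≤ L := by
  obtain ⟨h0, h1⟩ := hd
  rw [abs_le] at *
  constructor <;> nlinarith

/-- Excess risk of a plug-in minimizer in terms of the uniform error of the mixing weights. -/
lemma plugin_excess_risk_le {Θ : Type*} {D D' r₀ r₁ : Θ → ℝ} {L e : ℝ}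
    (hr₀ : ∀ θ, |r₀ θ| ≤ L) (hr₁ : ∀ θ, |r₁ θ| ≤ L) (hL : 0 ≤ L)
    (he : ∀ θ, |D' θ - D θ| ≤ e) {t s : Θ}
    (ht : D' t * r₁ t + (1 - D' t) * r₀ t ≤ D' s * r₁ s + (1 - D' s) * r₀ s) :
    (D t * r₁ t + (1 - D t) * r₀ t) - (D s * r₁ s + (1 - D s) * r₀ s) ≤ 4 * L * e := by
  have hb : ∀ θ, |(D' θ * r₁ θ + (1 - D' θ) * r₀ θ) - (D θ * r₁ θ + (1 - D θ) * r₀ θ)|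
      ≤ 2 * L * e := fun θ =>
    (abs_mixture_sub_le (hr₁ θ) (hr₀ θ)).trans (by gcongr; exact he θ)
  have h₁ := abs_le.1 (hb t)
  have h₂ := abs_le.1 (hb s)
  linarith [h₁.1, h₂.2]

/-- With exploration length `⌈T^α⌉` and `α = 1 / (1 + η)`, the estimation rate accumulated over
`T` steps is of order `T^α`. -/
lemma mul_estimation_rate_le {η α T ℓ : ℝ} (hη : 0 < η) (hα : α = 1 / (1 + η)) (hT : 1 ≤ T)
    (hTℓ : Real.log T ≤ ℓ) :
    T * (Real.log (⌈T ^ α⌉₊ : ℝ) / (⌈T ^ α⌉₊ : ℝ)) ^ η ≤ T ^ α * (1 + ℓ) ^ η := by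
  have hT0 : 0 < T := by linarith
  have hα0 : 0 < α := by rw [hα]; positivity
  have hα1 : α ≤ 1 := by
    rw [hα, div_le_one (by linarith)]
    linarith
  have hn : T ^ α ≤ (⌈T ^ α⌉₊ : ℝ) := Nat.le_ceil _
  have hpow1 : 1 ≤ T ^ α := Real.one_le_rpow hT hα0.le
  have hn0 : 1 ≤ (⌈T ^ α⌉₊ : ℝ) := hpow1.trans hn
  have hlogT : 0 ≤ Real.log T := Real.log_nonneg hT
  have hlog : Real.log (⌈T ^ α⌉₊ : ℝ) ≤ 1 + ℓ := by
    have hle : (⌈T ^ α⌉₊ : ℝ) ≤ 2 * T := by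
      have h₁ : (⌈T ^ α⌉₊ : ℝ) < T ^ α + 1 := Nat.ceil_lt_add_one (by positivity)
      have h₂ : T ^ α ≤ T := by
        simpa using Real.rpow_le_rpow_of_exponent_le hT hα1
      linarith
    have h := Real.log_le_log (by linarith) hle
    rw [Real.log_mul two_ne_zero hT0.ne'] at h
    linarith [Real.log_two_lt_d9]
  have hexp : T * (T ^ α) ^ (-η) = T ^ α := by
    rw [← Real.rpow_mul hT0.le]
    nth_rewrite 1 [← Real.rpow_one T]
    rw [← Real.rpow_add hT0]
    congr 1
    rw [hα]
    field_simp
    ring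
  calc T * (Real.log (⌈T ^ α⌉₊ : ℝ) / (⌈T ^ α⌉₊ : ℝ)) ^ η
      ≤ T * ((1 + ℓ) / T ^ α) ^ η := by
        have hlog0 : 0 ≤ Real.log (⌈T ^ α⌉₊ : ℝ) := Real.log_nonneg hn0
        gcongr
        linarith
    _ = T * (T ^ α) ^ (-η) * (1 + ℓ) ^ η := by
        rw [Real.div_rpow (by linarith) (by positivity), Real.rpow_neg (by positivity)]
        ring
    _ = T ^ α * (1 + ℓ) ^ η := by rw [hexp]

/-- Regret bound for the binary-action doubling-trick algorithm: if
during the exploitation phase of each episode `k` the plug-in minimizer `θ̂⁽ᵏ⁾` of the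
estimated performative risk is deployed, and the uniform estimation errors
`E_k = sup_θ |D̂₁⁽ᵏ⁾(θ) - D₁(θ)|` satisfy the `O_P((log |ℐ_k| / |ℐ_k|)^η)` assumption,
then the total regret satisfies `Reg(M) = O_P(M^{1/(1+η)} log^η M)` along
`M = τ₀(2^K - 1)`, `K → ∞`. -/
theorem doubling_trick_regret_bound
    {Ω : Type*} [MeasurableSpace Ω] (P : Measure Ω) [IsProbabilityMeasure P]
    {Θ : Type*} [Nonempty Θ]
    (η : ℝ) (hη : η ∈ Set.Ioo (0 : ℝ) 1) (α : ℝ) (hα : α = 1 / (1 + η))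
    (τ₀ : ℕ) (hτ₀ : 2 ≤ τ₀)
    (D₁ : Θ → ℝ) (hD₁ : ∀ θ, D₁ θ ∈ Set.Icc (0 : ℝ) 1)
    (L : ℝ) (r₀ r₁ : Θ → ℝ) (hr₀ : ∀ θ, |r₀ θ| ≤ L) (hr₁ : ∀ θ, |r₁ θ| ≤ L)
    -- `θ*` minimizes the true performative risk `PR(θ) = D₁(θ) r₁(θ) + (1 - D₁(θ)) r₀(θ)`
    (θstar : Θ)
    (hθstar : ∀ θ : Θ,
        D₁ θstar * r₁ θstar + (1 - D₁ θstar) * r₀ θstar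
          ≤ D₁ θ * r₁ θ + (1 - D₁ θ) * r₀ θ)
    -- random estimates `D̂₁⁽ᵏ⁾` of the distribution map, valued in `[0,1]`
    (Dhat : ℕ → Ω → Θ → ℝ) (hDhat : ∀ k ω θ, Dhat k ω θ ∈ Set.Icc (0 : ℝ) 1)
    -- `θ̂⁽ᵏ⁾` minimizes the plug-in risk `P̂R⁽ᵏ⁾(θ) = D̂₁⁽ᵏ⁾(θ) r₁(θ) + (1 - D̂₁⁽ᵏ⁾(θ)) r₀(θ)`
    (θhat : ℕ → Ω → Θ)
    (hθhat : ∀ k ω θ,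
        Dhat k ω (θhat k ω) * r₁ (θhat k ω) + (1 - Dhat k ω (θhat k ω)) * r₀ (θhat k ω)
          ≤ Dhat k ω θ * r₁ θ + (1 - Dhat k ω θ) * r₀ θ)
    -- the deployed models: during the exploitation phase `ℐ'_k` of episode `k`
    -- (exploration deployments are arbitrary), the model `θ̂⁽ᵏ⁾` is deployed
    (deploy : ℕ → Ω → Θ)
    (hdeploy : ∀ k m ω, episodeStart τ₀ k + exploreLen τ₀ α k ≤ m →
        m ≤ episodeEnd τ₀ k → deploy m ω = θhat k ω)
    -- the `O_P` assumption on the uniform estimation errors `E_k`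
    (hE : ∀ ε > (0 : ℝ), ∃ c > (0 : ℝ), ∃ K₀ : ℕ, ∀ K : ℕ,
        P {ω | ∃ k, K₀ ≤ k ∧ k ≤ K ∧
            c * (Real.log (exploreLen τ₀ α k : ℝ) / (exploreLen τ₀ α k : ℝ)) ^ η
              < ⨆ θ, |Dhat k ω θ - D₁ θ|}
          ≤ ENNReal.ofReal ε) :
    -- conclusion: `Reg(M) = O_P(M^{1/(1+η)} (1 + log M)^η)` along `M = τ₀(2^K - 1)`
    ∀ ε > (0 : ℝ), ∃ C > (0 : ℝ),
      Filter.limsup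
        (fun K : ℕ =>
          P {ω | C * ((episodeEnd τ₀ K : ℝ)) ^ ((1 : ℝ) / (1 + η)) *
                  (1 + Real.log (episodeEnd τ₀ K : ℝ)) ^ η
              < ∑ m ∈ Finset.Icc 1 (episodeEnd τ₀ K),
                  ((D₁ (deploy m ω) * r₁ (deploy m ω)
                      + (1 - D₁ (deploy m ω)) * r₀ (deploy m ω))
                    - (D₁ θstar * r₁ θstar + (1 - D₁ θstar) * r₀ θstar))})
        Filter.atTop
        ≤ ENNReal.ofReal ε := by
  intro ε hε
  obtain ⟨hη0, -⟩ := hη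
  obtain ⟨c, hc, K₀, hK₀⟩ := hE ε hε
  have hL : 0 ≤ L := (abs_nonneg _).trans (hr₀ θstar)
  have hα0 : 0 < α := by rw [hα]; positivity
  have hq : 1 < (2 : ℝ) ^ α := Real.one_lt_rpow one_lt_two hα0
  have hq' : 0 < (2 : ℝ) ^ α - 1 := by linarith
  rw [← hα]
  set q : ℝ := (2 : ℝ) ^ α / ((2 : ℝ) ^ α - 1) with hqdef
  have hq0 : 0 < q := by positivity
  set A : ℝ := 4 * L + 4 * L * c + 2 * L * episodeLen τ₀ K₀ with hA
  have hA0 : 0 ≤ A := by positivity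
  refine ⟨A * q + 1, by positivity, ?_⟩
  refine limsup_le_of_le (by isBoundedDefault) ?_
  filter_upwards [eventually_ge_atTop 1] with K hK
  refine (measure_mono fun ω hω => ?_).trans (hK₀ K)
  by_contra hgood
  simp only [Set.mem_ofPred_eq, not_exists, not_and, not_lt] at hω hgood
  refine absurd hω (not_lt.2 ?_)
  set M : ℝ := (episodeEnd τ₀ K : ℝ) with hM
  have hM1 : 1 ≤ M := by
    rw [hM]
    obtain ⟨k, rfl⟩ : ∃ k, K = k + 1 := ⟨K - 1, by omega⟩
    have h₁ := episodeLen_le_episodeEnd τ₀ (Nat.lt_add_one k)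
    have h₂ := le_episodeLen τ₀ (k + 1)
    exact_mod_cast (by omega : 1 ≤ episodeEnd τ₀ (k + 1))
  have hlogM : 0 ≤ Real.log M := Real.log_nonneg hM1
  set ℓ : ℝ := (1 + Real.log M) ^ η with hℓ
  have hℓ1 : 1 ≤ ℓ := Real.one_le_rpow (by linarith) hη0.le
  have hdiff : ∀ θ, (D₁ θ * r₁ θ + (1 - D₁ θ) * r₀ θ)
      - (D₁ θstar * r₁ θstar + (1 - D₁ θstar) * r₀ θstar) ≤ 2 * L := by
    intro θ
    have h₁ := abs_le.1 (abs_mixture_le (hD₁ θ) (hr₁ θ) (hr₀ θ))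
    have h₂ := abs_le.1 (abs_mixture_le (hD₁ θstar) (hr₁ θstar) (hr₀ θstar))
    linarith [h₁.2, h₂.1]
  have hsum := sum_Icc_episodeEnd_le τ₀ K
    (fun m => (D₁ (deploy m ω) * r₁ (deploy m ω) + (1 - D₁ (deploy m ω)) * r₀ (deploy m ω))
      - (D₁ θstar * r₁ θstar + (1 - D₁ θstar) * r₀ θstar))
    (fun k => A * ℓ * (episodeLen τ₀ (k + 1) : ℝ) ^ α) ?_
  · rw [← Finset.mul_sum] at hsum
    have hMα : 0 ≤ M ^ α := by positivity
    calc _ ≤ A * ℓ * (q * M ^ α) :=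
          hsum.trans (mul_le_mul_of_nonneg_left (sum_episodeLen_rpow_le τ₀ hα0 hK) (by positivity))
      _ ≤ (A * q + 1) * M ^ α * ℓ := by nlinarith [mul_nonneg hMα (zero_le_one.trans hℓ1)]
  intro k hk
  set T : ℝ := (episodeLen τ₀ (k + 1) : ℝ) with hT
  have hT1 : 1 ≤ T := by
    have := le_episodeLen τ₀ (k + 1)
    rw [hT]
    exact_mod_cast (by omega : 1 ≤ episodeLen τ₀ (k + 1))
  have hTα : 1 ≤ T ^ α := Real.one_le_rpow hT1 hα0.le
  have hTℓ : 1 ≤ T ^ α * ℓ := one_le_mul_of_one_le_of_one_le hTα hℓ1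
  rcases lt_or_ge (k + 1) K₀ with hlt | hge
  · have h := sum_Ioc_le_of_two_phases
      (fun m => (D₁ (deploy m ω) * r₁ (deploy m ω) + (1 - D₁ (deploy m ω)) * r₀ (deploy m ω))
        - (D₁ θstar * r₁ θstar + (1 - D₁ θstar) * r₀ θstar))
      (episodeEnd τ₀ k) (episodeLen τ₀ (k + 1)) 0 (2 * L) (2 * L) (by positivity) (by positivity)
      (fun m => hdiff _) (fun m _ _ => hdiff _)
    have hTK : T ≤ episodeLen τ₀ K₀ := by
      rw [hT]
      exact_mod_cast episodeLen_mono τ₀ hlt.le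
    calc _ ≤ 2 * L * T := h.trans_eq (by push_cast; ring)
      _ ≤ 2 * L * episodeLen τ₀ K₀ := by gcongr
      _ ≤ A := by
        rw [hA]
        have : 0 ≤ 4 * L + 4 * L * c := by positivity
        linarith
      _ ≤ A * (T ^ α * ℓ) := le_mul_of_one_le_right hA0 hTℓ
      _ = A * ℓ * T ^ α := by ring
  · set e : ℝ := (Real.log (exploreLen τ₀ α (k + 1) : ℝ) / (exploreLen τ₀ α (k + 1) : ℝ)) ^ η
      with he
    have he0 : 0 ≤ e := by positivity
    have herr : ∀ θ, |Dhat (k + 1) ω θ - D₁ θ| ≤ c * e := by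
      intro θ
      refine (le_ciSup (f := fun θ => |Dhat (k + 1) ω θ - D₁ θ|) ⟨1, ?_⟩ θ).trans
        (hgood (k + 1) hge hk)
      rintro _ ⟨θ', rfl⟩
      have h₁ := hDhat (k + 1) ω θ'
      have h₂ := hD₁ θ'
      exact abs_le.2 ⟨by linarith [h₁.1, h₂.2], by linarith [h₁.2, h₂.1]⟩
    have h := sum_Ioc_le_of_two_phases
      (fun m => (D₁ (deploy m ω) * r₁ (deploy m ω) + (1 - D₁ (deploy m ω)) * r₀ (deploy m ω))
        - (D₁ θstar * r₁ θstar + (1 - D₁ θstar) * r₀ θstar))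
      (episodeEnd τ₀ k) (episodeLen τ₀ (k + 1)) (exploreLen τ₀ α (k + 1)) (2 * L)
      (4 * L * (c * e)) (by positivity) (by positivity) (fun m => hdiff _) (fun m hm₁ hm₂ => by
        have hm : deploy m ω = θhat (k + 1) ω :=
          hdeploy (k + 1) m ω (by rw [episodeStart_succ]; omega) (by rwa [episodeEnd_succ])
        simp only [hm]
        exact plugin_excess_risk_le hr₀ hr₁ hL herr (hθhat (k + 1) ω θstar))
    have hlogT : Real.log T ≤ Real.log M := by
      refine Real.log_le_log (by linarith) ?_
      rw [hT, hM]
      exact_mod_cast episodeLen_le_episodeEnd τ₀ hk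
    have hrate : T * e ≤ T ^ α * ℓ := mul_estimation_rate_le hη0 hα hT1 hlogT
    have hn : (exploreLen τ₀ α (k + 1) : ℝ) ≤ 2 * (T ^ α * ℓ) := by
      have h₁ : (exploreLen τ₀ α (k + 1) : ℝ) < T ^ α + 1 :=
        Nat.ceil_lt_add_one (by positivity)
      have h₂ : T ^ α ≤ T ^ α * ℓ := le_mul_of_one_le_right (by positivity) hℓ1
      linarith
    calc _ ≤ exploreLen τ₀ α (k + 1) * (2 * L) + 4 * L * c * (T * e) :=
          h.trans_eq (by ring)
      _ ≤ 2 * (T ^ α * ℓ) * (2 * L) + 4 * L * c * (T ^ α * ℓ) := by gcongr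
      _ = (4 * L + 4 * L * c) * (T ^ α * ℓ) := by ring
      _ ≤ A * (T ^ α * ℓ) := by
        gcongr
        rw [hA]
        exact le_add_of_nonneg_right (by positivity)
      _ = A * ℓ * T ^ α := by ring
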